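/- arXiv:2505.11229 — 3 statements merged into one kernel-verified Lean document; each statement's English description precedes it below -/
import Mathlib

section
/- Let ι be a type with decidable equality, f : (ι → Bool) → Bool, and l a duplicate-free list of indices in ι. Then for every assignment a : ι → Bool, (List.foldr (fun i g => exQ i g) f l) a = true if and only if there exists b : ι → Bool with b i = a i for every i not in l and f b = true. In particular, for any two duplicate-free lists with the same set of elements, the folded quantifications yield the same function, so quantifying a finite set of variables one variable at a time is correct and order-independent. -/
def exQ {ι : Type*} [DecidableEq ι] (i : ι) (f : (ι → Bool) → Bool) : (ι → Bool) → Bool :=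
  fun a => f (Function.update a i true) || f (Function.update a i false)

theorem foldr_exQ_aux {ι : Type*} [DecidableEq ι] (f : (ι → Bool) → Bool) (l : List ι) :
    ∀ a : ι → Bool, (List.foldr (fun i g => exQ i g) f l) a = true ↔
        ∃ b : ι → Bool, (∀ i, i ∉ l → b i = a i) ∧ f b = true := by
  induction l with
  | nil =>
    intro a
    constructor
    · intro h
      exact ⟨a, fun _ _ => rfl, h⟩
    · rintro ⟨b, hb, h⟩
      have : b = a := funext fun i => hb i (by simp)
      subst this
      exact h
  | cons j l ih =>
    intro a
    have key : (List.foldr (fun i g => exQ i g) f (j :: l)) a = true ↔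
        ∃ c : Bool, (List.foldr (fun i g => exQ i g) f l) (Function.update a j c) = true := by
      simp [exQ, or_comm]
    rw [key]
    constructor
    · rintro ⟨c, hc⟩
      obtain ⟨b, hb, h⟩ := (ih _).1 hc
      refine ⟨b, fun i hi => ?_, h⟩
      rw [List.mem_cons, not_or] at hi
      rw [hb i hi.2, Function.update_of_ne hi.1]
    · rintro ⟨b, hb, h⟩
      refine ⟨b j, (ih _).2 ⟨b, fun i hi => ?_, h⟩⟩
      by_cases hij : i = j
      · subst hij
        simp
      · rw [Function.update_of_ne hij]
        exact hb i (by simp [hij, hi])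

theorem foldr_exQ_spec {ι : Type*} [DecidableEq ι] (f : (ι → Bool) → Bool)
    (l : List ι) (hl : l.Nodup) :
    (∀ a : ι → Bool,
      (List.foldr (fun i g => exQ i g) f l) a = true ↔
        ∃ b : ι → Bool, (∀ i, i ∉ l → b i = a i) ∧ f b = true) ∧
    (∀ l' : List ι, l'.Nodup → (∀ i, i ∈ l ↔ i ∈ l') →
      List.foldr (fun i g => exQ i g) f l = List.foldr (fun i g => exQ i g) f l') := by
  refine ⟨foldr_exQ_aux f l, fun l' _ h => ?_⟩
  funext a
  rw [Bool.eq_iff_iff, foldr_exQ_aux, foldr_exQ_aux]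
  simp only [h]
end

section
/- Let n : ℕ, S : (Fin n → Bool) → Bool be a set of states over the unprimed variables, and R : (Fin n → Bool) → (Fin n → Bool) → Bool a transition relation. Encode assignments over the interleaved variables as a : (Fin n ⊕ Fin n) → Bool, with Sum.inl the unprimed and Sum.inr the primed copies, and define χ a = S (a ∘ Sum.inl) && R (a ∘ Sum.inl) (a ∘ Sum.inr). Let E be obtained from χ by existentially quantifying, one at a time, every unprimed variable Sum.inl i for i : Fin n (via exQ, folded over any duplicate-free enumeration of the unprimed indices). Then for every t : Fin n → Bool, E (Sum.elim t t) = true if and only if there exists s : Fin n → Bool with S s = true and R s t = true. (Evaluating E at Sum.elim t t implements the monotone substitution [x′/x] of primed for unprimed variables.) -/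
theorem foldr_exQ_iff {n : ℕ} (χ : ((Fin n ⊕ Fin n) → Bool) → Bool) (l : List (Fin n)) :
    ∀ a : (Fin n ⊕ Fin n) → Bool,
      List.foldr (fun i g => exQ (Sum.inl i) g) χ l a = true ↔
        ∃ b, (∀ x, (∀ i ∈ l, x ≠ Sum.inl i) → b x = a x) ∧ χ b = true := by
  induction l with
  | nil =>
    intro a
    constructor
    · intro h
      exact ⟨a, fun _ _ => rfl, h⟩
    · rintro ⟨b, hb, h⟩
      have : b = a := funext fun x => hb x (by simp)
      subst this
      exact h
  | cons i l ih =>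
    intro a
    simp only [List.foldr_cons]
    rw [exQ, Bool.or_eq_true, ih, ih]
    constructor
    · rintro (⟨b, hb, h⟩ | ⟨b, hb, h⟩) <;>
      · refine ⟨b, fun x hx => ?_, h⟩
        rw [hb x fun j hj => hx j (List.mem_cons_of_mem _ hj),
          Function.update_of_ne (hx i List.mem_cons_self)]
    · rintro ⟨b, hb, h⟩
      have key : ∀ v, b (Sum.inl i) = v →
          ∀ x, (∀ j ∈ l, x ≠ Sum.inl j) → b x = Function.update a (Sum.inl i) v x := by
        intro v hv x hx
        by_cases hxi : x = Sum.inl i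
        · subst hxi
          simp [hv]
        · rw [Function.update_of_ne hxi]
          apply hb
          intro j hj
          rcases List.mem_cons.1 hj with rfl | hj
          · exact hxi
          · exact hx j hj
      cases hv : b (Sum.inl i)
      · exact Or.inr ⟨b, key _ hv, h⟩
      · exact Or.inl ⟨b, key _ hv, h⟩

theorem relnext_correct (n : ℕ) (S : (Fin n → Bool) → Bool)
    (R : (Fin n → Bool) → (Fin n → Bool) → Bool)
    (χ : ((Fin n ⊕ Fin n) → Bool) → Bool)
    (hχ : ∀ a : (Fin n ⊕ Fin n) → Bool,
      χ a = (S (a ∘ Sum.inl) && R (a ∘ Sum.inl) (a ∘ Sum.inr)))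
    (l : List (Fin n)) (hl : l.Nodup) (hcomplete : ∀ i : Fin n, i ∈ l)
    (E : ((Fin n ⊕ Fin n) → Bool) → Bool)
    (hE : E = List.foldr (fun i g => exQ (Sum.inl i) g) χ l)
    (t : Fin n → Bool) :
    E (Sum.elim t t) = true ↔ ∃ s : Fin n → Bool, S s = true ∧ R s t = true := by
  rw [hE, foldr_exQ_iff]
  constructor
  · rintro ⟨b, hb, h⟩
    rw [hχ, Bool.and_eq_true] at h
    have hr : b ∘ Sum.inr = t := funext fun i => hb (Sum.inr i) (by simp)
    rw [hr] at h
    exact ⟨_, h⟩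
  · rintro ⟨s, hs, hR⟩
    refine ⟨Sum.elim s t, ?_, ?_⟩
    · rintro (i | i) hx
      · exact absurd rfl (hx i (hcomplete i))
      · rfl
    · rw [hχ, Sum.elim_comp_inl, Sum.elim_comp_inr, hs, hR]
      rfl
end

section
/- Let σ be a finite type with N = Fintype.card σ, R : σ → σ → Prop, and I : Set σ. Define the iteration S₀ = I and S_{k+1} = S_k ∪ Next S_k R. Then the iteration stabilizes after at most N steps: S_N = Reach I R, and S_k = S_N for every k ≥ N. Hence reachability analysis over a finite state space terminates after at most |σ| applications of the relational product. -/
def Next {σ : Type*} (S : Set σ) (R : σ → σ → Prop) : Set σ := {t | ∃ s ∈ S, R s t}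

def Reach {σ : Type*} (I : Set σ) (R : σ → σ → Prop) : Set σ :=
  {t | ∃ s ∈ I, Relation.ReflTransGen R s t}

theorem iter_stabilizes {σ : Type*} [Fintype σ] (R : σ → σ → Prop) (I : Set σ)
    (Sseq : ℕ → Set σ) (h0 : Sseq 0 = I)
    (hsucc : ∀ k, Sseq (k + 1) = Sseq k ∪ Next (Sseq k) R) :
    Sseq (Fintype.card σ) = Reach I R ∧
    ∀ k, Fintype.card σ ≤ k → Sseq k = Sseq (Fintype.card σ) := by
  have hmono : ∀ k, Sseq k ⊆ Sseq (k + 1) := by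
    intro k
    rw [hsucc k]
    exact Set.subset_union_left
  have hclaim : ∀ k, k ≤ (Sseq k).ncard ∨ ∃ j, j < k ∧ Sseq (j + 1) = Sseq j := by
    intro k
    induction k with
    | zero => exact Or.inl (Nat.zero_le _)
    | succ k ih =>
      rcases ih with h | ⟨j, hj, he⟩
      · by_cases he : Sseq (k + 1) = Sseq k
        · exact Or.inr ⟨k, Nat.lt_succ_self k, he⟩
        · left
          have hlt : (Sseq k).ncard < (Sseq (k + 1)).ncard :=
            Set.ncard_lt_ncard ((hmono k).ssubset_of_ne (Ne.symm he)) (Set.toFinite _)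
          omega
      · exact Or.inr ⟨j, by omega, he⟩
  have hex : ∃ j, j ≤ Fintype.card σ ∧ Sseq (j + 1) = Sseq j := by
    rcases hclaim (Fintype.card σ) with h | ⟨j, hj, he⟩
    · refine ⟨_, le_rfl, ?_⟩
      have hu : Sseq (Fintype.card σ) = Set.univ := by
        apply Set.eq_of_subset_of_ncard_le (Set.subset_univ _) _ (Set.toFinite _)
        rw [Set.ncard_univ, Nat.card_eq_fintype_card]
        exact h
      apply Set.Subset.antisymm _ (hmono _)
      rw [hu]
      exact Set.subset_univ _
    · exact ⟨j, hj.le, he⟩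
  obtain ⟨j, hj, he⟩ := hex
  have hstab : ∀ m, j ≤ m → Sseq m = Sseq j := by
    intro m hm
    induction m, hm using Nat.le_induction with
    | base => rfl
    | succ m hm ih => rw [hsucc m, ih, ← hsucc j, he]
  refine ⟨?_, fun k hk => by rw [hstab k (hj.trans hk), hstab _ hj]⟩
  have hsub : ∀ k, Sseq k ⊆ Reach I R := by
    intro k
    induction k with
    | zero =>
      intro t ht
      exact ⟨t, h0 ▸ ht, Relation.ReflTransGen.refl⟩
    | succ k ih =>
      rw [hsucc k]
      rintro t (ht | ⟨s, hs, hst⟩)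
      · exact ih ht
      · obtain ⟨i, hi, his⟩ := ih hs
        exact ⟨i, hi, his.tail hst⟩
  apply Set.Subset.antisymm (hsub _)
  rintro t ⟨s, hs, hst⟩
  rw [hstab _ hj]
  induction hst with
  | refl =>
    have h := monotone_nat_of_le_succ hmono (Nat.zero_le j)
    exact h (h0.symm ▸ hs)
  | tail _ hbc ih =>
    rw [← he, hsucc j]
    exact Or.inr ⟨_, ih, hbc⟩
end
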